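/- Let (B, Tⁿ, p, F) be a fiber bundle over the n-torus Tⁿ = (ℝ/ℤ)ⁿ with path-connected locally compact Hausdorff fiber F, admitting a finite trivializing open cover. If the total space B has property 𝒫 (every continuous map ∂(Iᵐ) → B identifying opposite faces of the cube is null-homotopic, for all m), then the bundle admits a continuous global section s : Tⁿ → B. -/

import Mathlib

/-- `U` is a trivializing open set for `p : B → X` with fibre `F`: there is a
homeomorphism `U × F ≃ₜ p⁻¹(U)` commuting with the projection to `U`. -/
def IsTrivializationOver {B X : Type*} (F : Type*) [TopologicalSpace B]
    [TopologicalSpace X] [TopologicalSpace F] (p : B → X) (U : Set X) : Prop :=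
  ∃ φ : ↥U × F ≃ₜ ↥(p ⁻¹' U), ∀ z, p (φ z : B) = (z.1 : X)

/-- A fibre bundle with fibre `F` (admitting a finite trivializing open cover):
a continuous surjection `p : B → X` together with a finite open cover of `X` by
trivializing sets. -/
def IsFiniteFiberBundle {B X : Type*} (F : Type*) [TopologicalSpace B]
    [TopologicalSpace X] [TopologicalSpace F] (p : B → X) : Prop :=
  Continuous p ∧ Function.Surjective p ∧
    ∃ (ι : Type) (_ : Finite ι) (U : ι → Set X),
      (∀ i, IsOpen (U i)) ∧ (⋃ i, U i) = Set.univ ∧ ∀ i, IsTrivializationOver F p (U i)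

/-- A bundle map `f : B → B'` covering `fbar : X → X'`: `f` is continuous,
commutes with the projections, and restricts to a homeomorphism on each fibre. -/
def IsBundleMap {B X B' X' : Type*} [TopologicalSpace B] [TopologicalSpace X]
    [TopologicalSpace B'] [TopologicalSpace X']
    (p : B → X) (p' : B' → X') (f : B → B') (fbar : X → X') : Prop :=
  Continuous f ∧ Continuous fbar ∧ (∀ b, p' (f b) = fbar (p b)) ∧
    ∀ x : X, ∃ e : ↥(p ⁻¹' {x}) ≃ₜ ↥(p' ⁻¹' {fbar x}), ∀ b, (e b : B') = f (b : B)


/-- The boundary of the `n`-cube `Iⁿ = [0,1]ⁿ`. -/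
def cubeBoundary (n : ℕ) : Set (Fin n → unitInterval) :=
  {x | ∃ i, x i = 0 ∨ x i = 1}

/-- A map on the boundary of the cube identifies opposite faces. -/
def IdentifiesOppositeFaces {n : ℕ} {X : Type*} [TopologicalSpace X]
    (f : C(cubeBoundary n, X)) : Prop :=
  ∀ (x : Fin n → unitInterval) (i : Fin n),
    f ⟨Function.update x i 0, ⟨i, Or.inl (by simp)⟩⟩ =
      f ⟨Function.update x i 1, ⟨i, Or.inr (by simp)⟩⟩

/-- Property 𝒫: every continuous map `∂(Iⁿ) → X` identifying opposite faces of the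
cube is null-homotopic. -/
def HasPropP (X : Type*) [TopologicalSpace X] : Prop :=
  ∀ (n : ℕ) (f : C(cubeBoundary n, X)), IdentifiesOppositeFaces f →
    ∃ c : X, f.Homotopic (ContinuousMap.const _ c)


open Set Topology

/-- Glue two functions along closed sets covering the space. -/
theorem glue_continuousOn {α β : Type*} [TopologicalSpace α] [TopologicalSpace β]
    {C₁ C₂ S : Set α} (h₁ : IsClosed C₁) (h₂ : IsClosed C₂) (hc : C₁ ∪ C₂ = univ)
    [∀ a, Decidable (a ∈ C₁)]
    {f g : α → β} (hf : ContinuousOn f (S ∩ C₁)) (hg : ContinuousOn g (S ∩ C₂))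
    (hfg : ∀ a ∈ S, a ∈ C₁ → a ∈ C₂ → f a = g a) :
    ContinuousOn (fun a => if a ∈ C₁ then f a else g a) S := by
  have hcl : closure {a | ¬ a ∈ C₁} ⊆ C₂ := by
    apply closure_minimal _ h₂
    intro a ha
    have : a ∈ C₁ ∪ C₂ := hc ▸ mem_univ a
    exact this.resolve_left ha
  apply ContinuousOn.if
  · rintro a ⟨haS, ha⟩
    have h3 : a ∈ C₁ := by
      have := ha.1
      rwa [show closure {a | a ∈ C₁} = C₁ from h₁.closure_eq] at this
    refine hfg a haS h3 ?_
    have : a ∈ frontier C₁ᶜ := by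
      rw [frontier_compl]; exact ha
    exact hcl this.1
  · rwa [show closure {a | a ∈ C₁} = C₁ from h₁.closure_eq]
  · exact hg.mono (inter_subset_inter_right _ hcl)

/-- The pullback of `p` along `q` is trivial over `S`. -/
def PTOn (F : Type*) {B X Y : Type*} [TopologicalSpace F] [TopologicalSpace B]
    [TopologicalSpace Y] (p : B → X) (q : Y → X) (S : Set Y) : Prop :=
  ∃ (Φ : Y × F → B) (Ψ : Y × B → F), ContinuousOn Φ (S ×ˢ univ) ∧
    ContinuousOn Ψ {z | z.1 ∈ S ∧ p z.2 = q z.1} ∧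
    (∀ y ∈ S, ∀ v, p (Φ (y, v)) = q y) ∧ (∀ y ∈ S, ∀ v, Ψ (y, Φ (y, v)) = v) ∧
    ∀ y ∈ S, ∀ b, p b = q y → Φ (y, Ψ (y, b)) = b

theorem PTOn.merge {F B X Y : Type*} [TopologicalSpace F] [TopologicalSpace B]
    [TopologicalSpace Y] {p : B → X} {q : Y → X} {S C₁ C₂ : Set Y}
    (h₁ : IsClosed C₁) (h₂ : IsClosed C₂) (hc : C₁ ∪ C₂ = univ)
    (H₁ : PTOn F p q (S ∩ C₁)) (H₂ : PTOn F p q (S ∩ C₂)) (r : Y → Y)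
    (hr : ContinuousOn r (S ∩ C₂)) (hrS : ∀ y ∈ S ∩ C₂, r y ∈ S ∧ r y ∈ C₁ ∧ r y ∈ C₂)
    (hrid : ∀ y ∈ S, y ∈ C₁ → y ∈ C₂ → r y = y) : PTOn F p q S := by
  classical
  obtain ⟨Φ₁, Ψ₁, cΦ₁, cΨ₁, a₁, b₁, d₁⟩ := H₁
  obtain ⟨Φ₂, Ψ₂, cΦ₂, cΨ₂, a₂, b₂, d₂⟩ := H₂
  have hC : ∀ y, y ∉ C₁ → y ∈ C₂ := fun y hy =>
    (show y ∈ C₁ ∪ C₂ from hc ▸ mem_univ y).resolve_left hy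
  have pre : ∀ {W : Type _} , (Prod.fst ⁻¹' C₁ ∪ Prod.fst ⁻¹' C₂ : Set (Y × W)) = univ := by
    intro W
    rw [← preimage_union, hc, preimage_univ]
  have pre' : ∀ {W : Type _} , (Prod.fst ⁻¹' C₁ ∪ Prod.fst ⁻¹' C₂ : Set (Y × W)) = univ := by
    intro W
    rw [← preimage_union, hc, preimage_univ]
  refine ⟨fun z => if z ∈ Prod.fst ⁻¹' C₁ then Φ₁ z else Φ₂ (z.1, Ψ₂ (r z.1, Φ₁ (r z.1, z.2))),
    fun z => if z ∈ Prod.fst ⁻¹' C₁ then Ψ₁ z else Ψ₁ (r z.1, Φ₂ (r z.1, Ψ₂ z)),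
    ?_, ?_, ?_, ?_, ?_⟩
  · apply glue_continuousOn (h₁.preimage continuous_fst) (h₂.preimage continuous_fst) pre
    · exact cΦ₁.mono fun z hz => ⟨⟨hz.1.1, hz.2⟩, trivial⟩
    · have k1 : ContinuousOn (fun z : Y × F => r z.1) ((S ×ˢ univ) ∩ Prod.fst ⁻¹' C₂) :=
        hr.comp continuousOn_fst fun z hz => ⟨hz.1.1, hz.2⟩
      have k2 : ContinuousOn (fun z : Y × F => Φ₁ (r z.1, z.2))
          ((S ×ˢ univ) ∩ Prod.fst ⁻¹' C₂) := by
        apply cΦ₁.comp (k1.prodMk continuousOn_snd)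
        intro z hz
        have := hrS z.1 ⟨hz.1.1, hz.2⟩
        exact ⟨⟨this.1, this.2.1⟩, trivial⟩
      have k3 : ContinuousOn (fun z : Y × F => Ψ₂ (r z.1, Φ₁ (r z.1, z.2)))
          ((S ×ˢ univ) ∩ Prod.fst ⁻¹' C₂) := by
        apply cΨ₂.comp (k1.prodMk k2)
        intro z hz
        have := hrS z.1 ⟨hz.1.1, hz.2⟩
        exact ⟨⟨this.1, this.2.2⟩, a₁ _ ⟨this.1, this.2.1⟩ _⟩
      apply cΦ₂.comp (continuousOn_fst.prodMk k3)
      intro z hz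
      exact ⟨⟨hz.1.1, hz.2⟩, trivial⟩
    · rintro ⟨y, v⟩ hz hz1 hz2
      have hz1 : y ∈ C₁ := hz1
      have hz2 : y ∈ C₂ := hz2
      have hS : y ∈ S := hz.1
      simp only [hrid y hS hz1 hz2]
      rw [d₂ y ⟨hS, hz2⟩ _ (a₁ y ⟨hS, hz1⟩ _)]
  · apply glue_continuousOn (h₁.preimage continuous_fst) (h₂.preimage continuous_fst) pre'
    · exact cΨ₁.mono fun z hz => ⟨⟨hz.1.1, hz.2⟩, hz.1.2⟩
    · have k1 : ContinuousOn (fun z : Y × B => r z.1)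
          ({z | z.1 ∈ S ∧ p z.2 = q z.1} ∩ Prod.fst ⁻¹' C₂) :=
        hr.comp continuousOn_fst fun z hz => ⟨hz.1.1, hz.2⟩
      have k2 : ContinuousOn (fun z : Y × B => Φ₂ (r z.1, Ψ₂ z))
          ({z | z.1 ∈ S ∧ p z.2 = q z.1} ∩ Prod.fst ⁻¹' C₂) := by
        apply cΦ₂.comp (k1.prodMk (cΨ₂.mono fun z hz => ⟨⟨hz.1.1, hz.2⟩, hz.1.2⟩))
        intro z hz
        have := hrS z.1 ⟨hz.1.1, hz.2⟩
        exact ⟨⟨this.1, this.2.2⟩, trivial⟩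
      apply cΨ₁.comp (k1.prodMk k2)
      intro z hz
      have := hrS z.1 ⟨hz.1.1, hz.2⟩
      exact ⟨⟨this.1, this.2.1⟩, a₂ _ ⟨this.1, this.2.2⟩ _⟩
    · rintro ⟨y, v⟩ hz hz1 hz2
      have hz1 : y ∈ C₁ := hz1
      have hz2 : y ∈ C₂ := hz2
      have hS : y ∈ S := hz.1
      simp only [hrid y hS hz1 hz2]
      rw [d₂ y ⟨hS, hz2⟩ _ hz.2]
  · intro y hy v
    by_cases h : y ∈ C₁
    · simpa [h] using a₁ y ⟨hy, h⟩ v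
    · simpa [h] using a₂ y ⟨hy, hC y h⟩ _
  · intro y hy v
    by_cases h : y ∈ C₁
    · simpa [h] using b₁ y ⟨hy, h⟩ v
    · have hh := hrS y ⟨hy, hC y h⟩
      simp only [mem_preimage, h, if_false]
      rw [b₂ y ⟨hy, hC y h⟩, d₂ _ ⟨hh.1, hh.2.2⟩ _ (a₁ _ ⟨hh.1, hh.2.1⟩ _),
        b₁ _ ⟨hh.1, hh.2.1⟩]
  · intro y hy b hb
    by_cases h : y ∈ C₁
    · simpa [h] using d₁ y ⟨hy, h⟩ b hb
    · have hh := hrS y ⟨hy, hC y h⟩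
      simp only [mem_preimage, h, if_false]
      rw [d₁ _ ⟨hh.1, hh.2.1⟩ _ (a₂ _ ⟨hh.1, hh.2.2⟩ _), b₂ _ ⟨hh.1, hh.2.2⟩,
        d₂ y ⟨hy, hC y h⟩ b hb]

theorem PTOn.of_triv {F B X Y : Type*} [TopologicalSpace F] [TopologicalSpace B]
    [TopologicalSpace X] [TopologicalSpace Y] [Nonempty F] [Nonempty B] {p : B → X} {q : Y → X} {S : Set Y}
    {U : Set X} (hU : IsTrivializationOver F p U) (hq : ContinuousOn q S)
    (hS : ∀ y ∈ S, q y ∈ U) : PTOn F p q S := by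
  classical
  obtain ⟨φ, hφ⟩ := hU
  refine ⟨fun z => if h : q z.1 ∈ U then (φ (⟨q z.1, h⟩, z.2) : B) else Classical.arbitrary B,
    fun z => if h : p z.2 ∈ U then (φ.symm ⟨z.2, h⟩).2 else Classical.arbitrary F,
    ?_, ?_, ?_, ?_, ?_⟩
  · rw [continuousOn_iff_continuous_domRestrict]
    have : (S ×ˢ (univ : Set F)).domRestrict (fun z : Y × F => if h : q z.1 ∈ U then
        (φ (⟨q z.1, h⟩, z.2) : B) else Classical.arbitrary B) =
        fun z => (φ (⟨q z.1.1, hS _ z.2.1⟩, z.1.2) : B) := by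
      ext z
      simp [hS _ z.2.1]
    rw [this]
    have hq' : Continuous (fun z : (S ×ˢ (univ : Set F) : Set (Y × F)) => q z.1.1) :=
      hq.comp_continuous (by fun_prop) fun z => z.2.1
    exact continuous_subtype_val.comp (φ.continuous.comp
      ((hq'.subtype_mk _).prodMk (by fun_prop)))
  · rw [continuousOn_iff_continuous_domRestrict]
    have hmem : ∀ z : {z : Y × B | z.1 ∈ S ∧ p z.2 = q z.1}, p z.1.2 ∈ U := fun z => by
      rw [z.2.2]; exact hS _ z.2.1
    have : {z : Y × B | z.1 ∈ S ∧ p z.2 = q z.1}.domRestrict (fun z : Y × B => if h : p z.2 ∈ U then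
        (φ.symm ⟨z.2, h⟩).2 else Classical.arbitrary F) =
        fun z => (φ.symm ⟨z.1.2, hmem z⟩).2 := by
      ext z
      simp [hmem z]
    rw [this]
    exact continuous_snd.comp (φ.symm.continuous.comp
      (Continuous.subtype_mk (by fun_prop) _))
  · intro y hy v
    simp [hS y hy, hφ]
  · intro y hy v
    simp [hS y hy, hφ]
  · intro y hy b hb
    have hb' : p b ∈ U := by rw [hb]; exact hS y hy
    have : (⟨q y, hS y hy⟩ : U) = (φ.symm ⟨b, hb'⟩).1 := by
      ext
      have := hφ (φ.symm ⟨b, hb'⟩)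
      simp at this
      rw [← this, hb]
    simp only [hS y hy, hb', dif_pos, this, Prod.mk.eta, Homeomorph.apply_symm_apply]

theorem PTOn.box {F B X : Type*} [TopologicalSpace F] [TopologicalSpace B]
    [TopologicalSpace X] [Nonempty F] [Nonempty B] {p : B → X} (hB : IsFiniteFiberBundle F p) {n : ℕ}
    {q : (Fin n → ℝ) → X} (hq : Continuous q) {l u : Fin n → ℝ} (hlu : l ≤ u) :
    PTOn F p q (Icc l u) := by
  obtain ⟨-, -, ι, -, U, hUo, hUc, hUt⟩ := hB
  obtain ⟨δ, hδ, hleb⟩ := lebesgue_number_lemma_of_metric (isCompact_Icc (a := l) (b := u))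
    (c := fun i => q ⁻¹' U i) (fun i => (hUo i).preimage hq)
    (by rw [← preimage_iUnion, hUc]; simp)
  have key : ∀ s : Finset (Fin n), ∀ a b : Fin n → ℝ, l ≤ a → b ≤ u → a ≤ b →
      (∀ i ∉ s, b i - a i ≤ δ / 2) → PTOn F p q (Icc a b) := by
    intro s
    induction s using Finset.induction_on with
    | empty =>
      intro a b hla hbu hab hs
      obtain ⟨i, hi⟩ := hleb a ⟨hla, hab.trans hbu⟩
      refine PTOn.of_triv (hUt i) hq.continuousOn fun y hy => hi ?_
      rw [Metric.mem_ball, dist_pi_lt_iff hδ]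
      intro j
      have := hs j (by simp)
      have h1 := hy.1 j
      have h2 := hy.2 j
      rw [Real.dist_eq, abs_lt]
      constructor <;> linarith
    | insert i s hi ih =>
      intro a b hla hbu hab hs
      obtain ⟨N, hN⟩ := exists_nat_ge ((b i - a i) / (δ / 2))
      rw [div_le_iff₀ (by positivity)] at hN
      induction N generalizing a with
      | zero =>
        apply ih a b hla hbu hab
        intro j hj
        by_cases hji : j = i
        · subst hji; simp at hN; linarith
        · exact hs j (by simp [hj, hji])
      | succ N ihN =>
        by_cases hsm : b i - a i ≤ δ / 2
        · apply ih a b hla hbu hab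
          intro j hj
          by_cases hji : j = i
          · subst hji; exact hsm
          · exact hs j (by simp [hj, hji])
        · have hc1 : a i ≤ a i + δ / 2 := by linarith
          have hc2 : a i + δ / 2 ≤ b i := by linarith
          have hbi := hbu i
          have hai := hla i
          have e1 : Icc a b ∩ {y | y i ≤ a i + δ / 2} = Icc a (Function.update b i (a i + δ / 2)) := by
            ext y
            simp only [mem_inter_iff, mem_Icc, mem_ofPred_eq, le_update_iff]
            constructor
            · rintro ⟨⟨h1, h2⟩, h3⟩
              exact ⟨h1, h3, fun j _ => h2 j⟩
            · rintro ⟨h1, h3, h2⟩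
              refine ⟨⟨h1, fun j => ?_⟩, h3⟩
              by_cases hj : j = i
              · subst hj; linarith
              · exact h2 j hj
          have e2 : Icc a b ∩ {y | a i + δ / 2 ≤ y i} = Icc (Function.update a i (a i + δ / 2)) b := by
            ext y
            simp only [mem_inter_iff, mem_Icc, mem_ofPred_eq, update_le_iff]
            constructor
            · rintro ⟨⟨h1, h2⟩, h3⟩
              exact ⟨⟨h3, fun j _ => h1 j⟩, h2⟩
            · rintro ⟨⟨h3, h1⟩, h2⟩
              refine ⟨⟨fun j => ?_, h2⟩, h3⟩
              by_cases hj : j = i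
              · subst hj; linarith
              · exact h1 j hj
          refine PTOn.merge (C₁ := {y | y i ≤ a i + δ / 2}) (C₂ := {y | a i + δ / 2 ≤ y i})
            (isClosed_le (by fun_prop) (by fun_prop)) (isClosed_le (by fun_prop) (by fun_prop))
            (by ext y; simpa using le_total _ _) ?_ ?_
            (fun y => Function.update y i (a i + δ / 2)) (by fun_prop) ?_ ?_
          · rw [e1]
            apply ih _ _ hla
            · rw [update_le_iff]
              exact ⟨by linarith, fun j _ => hbu j⟩
            · rw [le_update_iff]
              exact ⟨hc1, fun j _ => hab j⟩
            · intro j hj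
              by_cases hji : j = i
              · subst hji; simp
              · simpa [hji] using hs j (by simp [hj, hji])
          · rw [e2]
            apply ihN
            · rw [le_update_iff]
              exact ⟨by linarith, fun j _ => hla j⟩
            · rw [update_le_iff]
              exact ⟨hc2, fun j _ => hab j⟩
            · intro j hj
              have hji : j ≠ i := by rintro rfl; simp at hj
              simpa [hji] using hs j hj
            · simp only [Function.update_self]
              push_cast at hN
              linarith
          · rintro y ⟨⟨h1, h2⟩, h3⟩
            refine ⟨⟨?_, ?_⟩, by simp, by simp⟩
            · rw [le_update_iff]
              exact ⟨hc1, fun j _ => h1 j⟩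
            · rw [update_le_iff]
              exact ⟨hc2, fun j _ => h2 j⟩
          · rintro y _ h1 h2
            have : y i = a i + δ / 2 := le_antisymm h1 h2
            simp [← this]
  exact key Finset.univ l u le_rfl le_rfl hlu (by simp)

open unitInterval in
theorem exists_half_le {m : ℕ} {x : Fin m → ℝ} {r : ℝ} (hr : 0 < r)
    (h : r ≤ dist x (fun _ => 1 / 2)) : ∃ i, r ≤ |x i - 1 / 2| := by
  by_contra! hcon
  have : dist x (fun _ => 1 / 2) < r := by
    rw [dist_pi_lt_iff hr]
    intro i
    rw [Real.dist_eq]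
    exact hcon i
  linarith

theorem projIcc_of_half_le {t : ℝ} (h : 1 / 2 ≤ |t - 1 / 2|) :
    projIcc (0 : ℝ) 1 zero_le_one t = 0 ∨ projIcc (0 : ℝ) 1 zero_le_one t = 1 := by
  rcases le_abs.1 h with h | h
  · right
    exact projIcc_of_right_le _ (by linarith)
  · left
    exact projIcc_of_le_left _ (by linarith)

theorem dist_cube_le {m : ℕ} (y : Fin m → unitInterval) :
    dist (fun i => (y i : ℝ)) (fun _ => 1 / 2) ≤ 1 / 2 := by
  rw [dist_pi_le_iff (by norm_num)]
  intro i
  rw [Real.dist_eq, abs_le]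
  have := (y i).2.1
  have := (y i).2.2
  constructor <;> linarith

theorem dist_cube_eq {m : ℕ} {y : Fin m → unitInterval} (hy : y ∈ cubeBoundary m) :
    dist (fun i => (y i : ℝ)) (fun _ => 1 / 2) = 1 / 2 := by
  apply le_antisymm (dist_cube_le y)
  obtain ⟨i, hi⟩ := hy
  refine le_trans ?_ (dist_le_pi_dist _ _ i)
  rw [Real.dist_eq]
  rcases hi with hi | hi <;> rw [hi] <;> norm_num [abs_of_neg]

theorem cubeBoundary_preconnected {m : ℕ} (hm : 2 ≤ m) : PreconnectedSpace (cubeBoundary m) := by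
  have h : cubeBoundary m = (fun (x : Fin m → ℝ) i => projIcc (0 : ℝ) 1 zero_le_one (x i)) ''
      Metric.sphere (fun _ => 1 / 2) (1 / 2) := by
    ext y
    constructor
    · intro hy
      refine ⟨fun i => y i, ?_, ?_⟩
      · rw [Metric.mem_sphere]
        exact dist_cube_eq hy
      · ext i
        simp
    · rintro ⟨x, hx, rfl⟩
      rw [Metric.mem_sphere] at hx
      obtain ⟨i, hi⟩ := exists_half_le (by norm_num) hx.ge
      exact ⟨i, projIcc_of_half_le hi⟩
  apply Subtype.preconnectedSpace
  rw [h]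
  apply IsPreconnected.image
  · apply isPreconnected_sphere
    simp
    exact_mod_cast hm
  · apply Continuous.continuousOn
    fun_prop

theorem isClosed_cubeBoundary (m : ℕ) : IsClosed (cubeBoundary m) := by
  have : cubeBoundary m = ⋃ i, {x | x i = 0 ∨ x i = 1} := by
    ext x
    simp [cubeBoundary]
  rw [this]
  apply isClosed_iUnion_of_finite
  intro i
  apply IsClosed.union
  · exact isClosed_eq (continuous_apply i) continuous_const
  · exact isClosed_eq (continuous_apply i) continuous_const

theorem cone_extend {m : ℕ} {F : Type*} [TopologicalSpace F] (f : C(cubeBoundary m, F)) (c : F)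
    (h : f.Homotopic (ContinuousMap.const _ c)) :
    ∃ g : C(Fin m → unitInterval, F), ∀ y (hy : y ∈ cubeBoundary m), g y = f ⟨y, hy⟩ := by
  classical
  obtain ⟨H⟩ := h
  let ρ : (Fin m → unitInterval) → ℝ := fun y => dist (fun i => (y i : ℝ)) (fun _ => 1 / 2) * 2
  have hρ : Continuous ρ := by
    unfold ρ
    fun_prop
  let b : (Fin m → unitInterval) → (Fin m → unitInterval) := fun y i =>
    projIcc (0 : ℝ) 1 zero_le_one (1 / 2 + ((y i : ℝ) - 1 / 2) / max (ρ y) (1 / 2))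
  have hpos : ∀ y, 0 < max (ρ y) (1 / 2) := fun y => lt_max_of_lt_right (by norm_num)
  have hb : Continuous b := by
    refine continuous_pi fun i => continuous_projIcc.comp ?_
    refine continuous_const.add (Continuous.div ?_ ?_ fun y => (hpos y).ne')
    · fun_prop
    · fun_prop
  have hbdry : ∀ y, 1 / 2 ≤ ρ y → b y ∈ cubeBoundary m := by
    intro y hy
    obtain ⟨i, hi⟩ := exists_half_le (r := ρ y / 2) (x := fun i => (y i : ℝ)) (by linarith)
      (by simp [ρ])
    refine ⟨i, projIcc_of_half_le ?_⟩
    rw [max_eq_left hy]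
    rw [add_sub_cancel_left, abs_div, abs_of_pos (by linarith : 0 < ρ y), le_div_iff₀ (by linarith)]
    linarith
  let t : (Fin m → unitInterval) → unitInterval := fun y =>
    projIcc (0 : ℝ) 1 zero_le_one (2 - 2 * ρ y)
  have ht : Continuous t := continuous_projIcc.comp (by fun_prop)
  let H' : (Fin m → unitInterval) → F := fun y =>
    if hy : 1 / 2 ≤ ρ y then H (t y, ⟨b y, hbdry y hy⟩) else c
  have hH' : ContinuousOn H' {y | 1 / 2 ≤ ρ y} := by
    rw [continuousOn_iff_continuous_domRestrict]
    have : {y | 1 / 2 ≤ ρ y}.domRestrict H' =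
        fun y : {y | 1 / 2 ≤ ρ y} => H (t y.1, ⟨b y.1, hbdry y.1 y.2⟩) := by
      ext y
      have : 1 / 2 ≤ ρ y := y.2
      simp only [Set.domRestrict_apply, H']
      rw [dif_pos this]
    rw [this]
    refine H.continuous.comp (Continuous.prodMk (by fun_prop) (Continuous.subtype_mk (by fun_prop) _))
  refine ⟨⟨fun y => if y ∈ {y | 1 / 2 ≤ ρ y} then H' y else c, ?_⟩, ?_⟩
  · rw [← continuousOn_univ]
    apply glue_continuousOn (C₂ := {y | ρ y ≤ 1 / 2}) (isClosed_le continuous_const hρ)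
      (isClosed_le hρ continuous_const)
    · ext y
      simpa using le_total _ _
    · exact hH'.mono inter_subset_right
    · exact continuousOn_const
    · intro y _ h1 h2
      have h1 : 1 / 2 ≤ ρ y := h1
      have h2 : ρ y ≤ 1 / 2 := h2
      have : t y = 1 := projIcc_of_right_le _ (by linarith)
      simp only [H']
      rw [dif_pos h1, this, H.apply_one]
      rfl
  · intro y hy
    have e : ρ y = 1 := by
      simp only [ρ]
      rw [dist_cube_eq hy]
      norm_num
    have h1 : 1 / 2 ≤ ρ y := by rw [e]; norm_num
    have h2 : t y = 0 := projIcc_of_le_left _ (by rw [e]; norm_num)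
    have h3 : b y = y := by
      ext i
      simp only [b, e]
      rw [max_eq_left (by norm_num), div_one, add_sub_cancel, projIcc_val]
    simp only [ContinuousMap.coe_mk]
    rw [if_pos (show y ∈ {y | 1 / 2 ≤ ρ y} from h1)]
    simp only [H']
    rw [dif_pos h1, h2, H.apply_zero]
    congr 2

/-- The fundamental filling step. -/
theorem fill_cube {B F : Type*} [TopologicalSpace B] [TopologicalSpace F]
    [PathConnectedSpace F] {n m : ℕ}
    {p : B → (Fin n → AddCircle (1 : ℝ))} (hB : IsFiniteFiberBundle F p)
    (hP : HasPropP B) (L : C(Fin m → unitInterval, Fin n → ℝ)) (f : C(cubeBoundary m, B))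
    (hpf : ∀ y, p (f y) = fun i => ((L y.1 i : ℝ) : AddCircle (1 : ℝ)))
    (hid : IdentifiesOppositeFaces f) :
    ∃ S : C(Fin m → unitInterval, B),
      (∀ y, p (S y) = fun i => ((L y i : ℝ) : AddCircle (1 : ℝ))) ∧
      ∀ y (hy : y ∈ cubeBoundary m), S y = f ⟨y, hy⟩ := by
  have hpc : Continuous p := hB.1
  obtain ⟨c, ⟨H⟩⟩ := hP m f hid
  have : Nonempty B := ⟨c⟩
  have : CompactSpace (cubeBoundary m) :=
    isCompact_iff_compactSpace.1 (isClosed_cubeBoundary m).isCompact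
  have cov := AddCircle.isCoveringMap_coe (1 : ℝ)
  have hg : ∀ i, ∃ g : C(unitInterval × cubeBoundary m, ℝ),
      (∀ z, ((g z : ℝ) : AddCircle (1 : ℝ)) = p (H z) i) ∧ ∀ y, g (0, y) = L y.1 i := by
    intro i
    let K : C(unitInterval × cubeBoundary m, AddCircle (1 : ℝ)) :=
      ⟨fun z => p (H z) i, by fun_prop⟩
    let k : C(cubeBoundary m, ℝ) := ⟨fun y => L y.1 i, by fun_prop⟩
    have hk : ∀ a, K (0, a) = ((k a : ℝ) : AddCircle (1 : ℝ)) := by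
      intro a
      simp only [K, k, ContinuousMap.coe_mk, H.apply_zero, hpf]
    refine ⟨cov.liftHomotopy K k hk, fun z => ?_, fun y => cov.liftHomotopy_zero K k hk y⟩
    exact congrFun (cov.liftHomotopy_lifts K k hk) z
  choose g hg1 hg2 using hg
  let G : unitInterval × cubeBoundary m → (Fin n → ℝ) := fun z i => g i z
  have hG : Continuous G := continuous_pi fun i => (g i).continuous
  have hbd : Bornology.IsBounded (range G ∪ range L) :=
    (isCompact_range hG).isBounded.union (isCompact_range L.continuous).isBounded
  obtain ⟨R, hRpos, hR⟩ := hbd.subset_closedBall_lt 0 0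
  have hbox : ∀ x ∈ range G ∪ range L, x ∈ Icc (fun _ : Fin n => -R) (fun _ => R) := by
    intro x hx
    have := hR hx
    rw [mem_closedBall_zero_iff, pi_norm_le_iff_of_nonneg hRpos.le] at this
    exact ⟨fun i => (abs_le.1 (this i)).1, fun i => (abs_le.1 (this i)).2⟩
  have hGb : ∀ z, G z ∈ Icc (fun _ : Fin n => -R) (fun _ => R) :=
    fun z => hbox _ (Or.inl ⟨z, rfl⟩)
  have hLb : ∀ z, L z ∈ Icc (fun _ : Fin n => -R) (fun _ => R) :=
    fun z => hbox _ (Or.inr ⟨z, rfl⟩)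
  have hqc : Continuous (fun (x : Fin n → ℝ) i => ((x i : ℝ) : AddCircle (1 : ℝ))) :=
    continuous_pi fun i => (AddCircle.continuous_mk' (1 : ℝ)).comp (continuous_apply i)
  obtain ⟨Φ, Ψ, cΦ, cΨ, a, b, d⟩ := PTOn.box hB hqc
    (show (fun _ : Fin n => -R) ≤ (fun _ => R) from fun i => by simp; linarith)
  let fh : C(cubeBoundary m, F) := ⟨fun y => Ψ (L y.1, f y),
    cΨ.comp_continuous (by fun_prop) fun y => ⟨hLb _, hpf y⟩⟩
  have ext : ∃ e : C(Fin m → unitInterval, F), ∀ y (hy : y ∈ cubeBoundary m), e y = fh ⟨y, hy⟩ := by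
    rcases lt_or_ge m 2 with hm | hm
    · interval_cases m
      · refine ⟨ContinuousMap.const _ (Classical.arbitrary F), fun y hy => ?_⟩
        obtain ⟨i, -⟩ := hy
        exact i.elim0
      · have h0 : (fun _ => 0) ∈ cubeBoundary 1 := ⟨0, Or.inl rfl⟩
        have h1 : (fun _ => 1) ∈ cubeBoundary 1 := ⟨0, Or.inr rfl⟩
        let γ := PathConnectedSpace.somePath (fh ⟨_, h0⟩) (fh ⟨_, h1⟩)
        refine ⟨⟨fun y => γ (y 0), by fun_prop⟩, fun y hy => ?_⟩
        obtain ⟨i, hi⟩ := hy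
        obtain rfl : i = 0 := Subsingleton.elim _ _
        rcases hi with hi | hi
        · have : y = fun _ => 0 := by
            funext j
            rw [Subsingleton.elim j 0, hi]
          subst this
          exact γ.source
        · have : y = fun _ => 1 := by
            funext j
            rw [Subsingleton.elim j 0, hi]
          subst this
          exact γ.target
    · have := cubeBoundary_preconnected hm
      have y0 : cubeBoundary m := ⟨fun _ => 0, ⟨0, by omega⟩, Or.inl rfl⟩
      apply cone_extend fh (Ψ (G (1, y0), c))
      refine ⟨⟨⟨fun z => Ψ (G z, H z), ?_⟩, ?_, ?_⟩⟩
      · refine cΨ.comp_continuous (by fun_prop) fun z => ⟨hGb _, ?_⟩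
        funext i
        exact (hg1 i z).symm
      · intro y
        have : G (0, y) = L y.1 := by
          funext i
          exact hg2 i y
        simp [this, fh]
      · intro y
        have : G (1, y) = G (1, y0) := by
          funext i
          refine cov.const_of_comp (g := fun y => g i (1, y)) (by fun_prop) ?_ y y0
          intro y y'
          simp [hg1]
        simp [this]
  obtain ⟨e, he⟩ := ext
  refine ⟨⟨fun y => Φ (L y, e y), cΦ.comp_continuous (by fun_prop) fun y => ⟨hLb _, trivial⟩⟩,
    fun y => a _ (hLb y) _, fun y hy => ?_⟩
  simp only [ContinuousMap.coe_mk, he y hy, fh]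
  exact d _ (hLb y) _ (hpf ⟨y, hy⟩)

theorem coe_circle_eq {a b : unitInterval}
    (h : ((a : ℝ) : AddCircle (1 : ℝ)) = ((b : ℝ) : AddCircle (1 : ℝ))) :
    a = b ∨ ((a = 0 ∨ a = 1) ∧ (b = 0 ∨ b = 1)) := by
  rw [← sub_eq_zero, ← AddCircle.coe_sub, AddCircle.coe_eq_zero_iff] at h
  obtain ⟨k, hk⟩ := h
  have ha := a.2.1
  have ha' := a.2.2
  have hb := b.2.1
  have hb' := b.2.2
  simp only [zsmul_eq_mul, mul_one] at hk
  have h1 : (k : ℝ) < 2 := by linarith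
  have h2 : (-2 : ℝ) < k := by linarith
  have h1 : k < 2 := by exact_mod_cast h1
  have h2 : -2 < k := by exact_mod_cast h2
  have e0 : ∀ c : unitInterval, (c : ℝ) = 0 → c = 0 := fun c hc => Subtype.ext hc
  have e1 : ∀ c : unitInterval, (c : ℝ) = 1 → c = 1 := fun c hc => Subtype.ext hc
  obtain rfl | rfl | rfl : k = -1 ∨ k = 0 ∨ k = 1 := by omega
  · right
    push_cast at hk
    exact ⟨Or.inl (e0 _ (by linarith)), Or.inr (e1 _ (by linarith))⟩
  · left
    push_cast at hk
    exact Subtype.ext (by linarith)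
  · right
    push_cast at hk
    exact ⟨Or.inr (e1 _ (by linarith)), Or.inl (e0 _ (by linarith))⟩

theorem coe_circle_zero {a : unitInterval} :
    ((a : ℝ) : AddCircle (1 : ℝ)) = 0 ↔ a = 0 ∨ a = 1 := by
  constructor
  · intro h
    rcases coe_circle_eq (a := a) (b := 0) (by rw [h]; simp) with h | h
    · exact Or.inl h
    · exact h.1
  · rintro (rfl | rfl)
    · simp
    · simpa using AddCircle.coe_period (1 : ℝ)

theorem extend_face {B F : Type*} [TopologicalSpace B] [TopologicalSpace F]
    [PathConnectedSpace F] {n m : ℕ}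
    {p : B → (Fin n → AddCircle (1 : ℝ))} (hB : IsFiniteFiberBundle F p)
    (hP : HasPropP B) (e : Fin m ↪ Fin n) (s : (Fin n → AddCircle (1 : ℝ)) → B)
    (hs : ContinuousOn s {x | (∀ i ∉ range e, x i = 0) ∧ ∃ k, x (e k) = 0})
    (hps : ∀ x, (∀ i ∉ range e, x i = 0) → (∃ k, x (e k) = 0) → p (s x) = x) :
    ∃ s' : (Fin n → AddCircle (1 : ℝ)) → B,
      ContinuousOn s' {x | ∀ i ∉ range e, x i = 0} ∧
      (∀ x, (∀ i ∉ range e, x i = 0) → p (s' x) = x) ∧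
      ∀ x, (∀ i ∉ range e, x i = 0) → (∃ k, x (e k) = 0) → s' x = s x := by
  let L : C(Fin m → unitInterval, Fin n → ℝ) :=
    ⟨fun y i => Function.extend e (fun k => (y k : ℝ)) (fun _ => 0) i, by
      refine continuous_pi fun i => ?_
      by_cases hi : ∃ k, e k = i
      · obtain ⟨k, rfl⟩ := hi
        simp only [e.injective.extend_apply]
        fun_prop
      · simp only [Function.extend_apply' _ _ _ hi]
        fun_prop⟩
  let Q : (Fin m → unitInterval) → (Fin n → AddCircle (1 : ℝ)) :=
    fun y i => ((L y i : ℝ) : AddCircle (1 : ℝ))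
  have hQc : Continuous Q :=
    continuous_pi fun i => (AddCircle.continuous_mk' (1 : ℝ)).comp (by fun_prop)
  have hQe : ∀ y k, Q y (e k) = ((y k : ℝ) : AddCircle (1 : ℝ)) := by
    intro y k
    simp [Q, L, e.injective.extend_apply]
  have hQ0 : ∀ y, ∀ i ∉ range e, Q y i = 0 := by
    intro y i hi
    have hi : ¬ ∃ k, e k = i := hi
    simp [Q, L, Function.extend_apply' _ _ _ hi]
  have hQb : ∀ y, y ∈ cubeBoundary m ↔ ∃ k, Q y (e k) = 0 := by
    intro y
    simp only [hQe, coe_circle_zero]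
    rfl
  have hQext : ∀ y x, (∀ i ∉ range e, x i = 0) →
      (∀ k, ((y k : ℝ) : AddCircle (1 : ℝ)) = x (e k)) → Q y = x := by
    intro y x hx h
    funext i
    by_cases hi : i ∈ range e
    · obtain ⟨k, rfl⟩ := hi
      rw [hQe, h]
    · rw [hQ0 y i hi, hx i hi]
  have hQs : ∀ x : Fin n → AddCircle (1 : ℝ), (∀ i ∉ range e, x i = 0) → ∃ y, Q y = x := by
    intro x hx
    have : Fact ((0 : ℝ) < 1) := ⟨zero_lt_one⟩
    choose w hw hwx using fun k => AddCircle.eq_coe_Ico (x (e k))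
    exact ⟨fun k => ⟨w k, (hw k).1, (hw k).2.le⟩, hQext _ _ hx hwx⟩
  let f : C(cubeBoundary m, B) := ⟨fun y => s (Q y.1),
    hs.comp_continuous (by fun_prop) fun y => ⟨hQ0 _, (hQb _).1 y.2⟩⟩
  obtain ⟨S, hS1, hS2⟩ := fill_cube hB hP L f
    (fun y => hps _ (hQ0 _) ((hQb _).1 y.2)) (by
      intro x i
      have : Q (Function.update x i 0) = Q (Function.update x i 1) := by
        apply hQext _ _ (hQ0 _)
        intro k
        rw [hQe]
        by_cases hk : k = i
        · subst hk
          simpa using (AddCircle.coe_period (1 : ℝ)).symm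
        · simp [hk]
      simp only [f, ContinuousMap.coe_mk, this])
  have hSQ : ∀ y y', Q y = Q y' → S y = S y' := by
    intro y y' h
    by_cases hyy : y = y'
    · rw [hyy]
    · obtain ⟨k, hk⟩ := Function.ne_iff.1 hyy
      have h1 := congrFun h (e k)
      rw [hQe, hQe] at h1
      obtain ⟨h2, h3⟩ := (coe_circle_eq h1).resolve_left hk
      rw [hS2 y ⟨k, h2⟩, hS2 y' ⟨k, h3⟩]
      simp only [f, ContinuousMap.coe_mk, h]
  have hs' : ∀ y, S (Function.invFun Q (Q y)) = S y := fun y =>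
    hSQ _ _ (Function.invFun_eq ⟨y, rfl⟩)
  refine ⟨fun x => S (Function.invFun Q x), ?_, ?_, ?_⟩
  · rw [continuousOn_iff_continuous_domRestrict]
    let Q' : (Fin m → unitInterval) → {x : Fin n → AddCircle (1 : ℝ) | ∀ i ∉ range e, x i = 0} :=
      fun y => ⟨Q y, hQ0 y⟩
    have hQ'c : Continuous Q' := hQc.subtype_mk _
    have hQ's : Function.Surjective Q' := by
      rintro ⟨x, hx⟩
      obtain ⟨y, rfl⟩ := hQs x hx
      exact ⟨y, rfl⟩
    have hq : IsQuotientMap Q' := hQ'c.isClosedMap.isQuotientMap hQ'c hQ's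
    rw [hq.continuous_iff]
    convert S.continuous using 1
    funext y
    exact hs' y
  · intro x hx
    obtain ⟨y, rfl⟩ := hQs x hx
    simp only [hs']
    exact hS1 y
  · intro x hx hx'
    obtain ⟨y, rfl⟩ := hQs x hx
    simp only [hs']
    rw [hS2 y ((hQb y).2 hx')]
    rfl

theorem skeleton_section {B F : Type*} [TopologicalSpace B] [TopologicalSpace F]
    [PathConnectedSpace F] {n : ℕ}
    {p : B → (Fin n → AddCircle (1 : ℝ))} (hB : IsFiniteFiberBundle F p)
    (hP : HasPropP B) (j : ℕ) (hj : j ≤ n) :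
    ∃ s : (Fin n → AddCircle (1 : ℝ)) → B,
      ContinuousOn s {x | ∃ A : Finset (Fin n), A.card = j ∧ ∀ i ∉ A, x i = 0} ∧
      ∀ x, (∃ A : Finset (Fin n), A.card = j ∧ ∀ i ∉ A, x i = 0) → p (s x) = x := by
  classical
  induction j with
  | zero =>
    obtain ⟨b, hb⟩ := hB.2.1 0
    refine ⟨fun _ => b, continuousOn_const, ?_⟩
    rintro x ⟨A, hA, hx⟩
    obtain rfl := Finset.card_eq_zero.1 hA
    rw [hb]
    funext i
    exact (hx i (by simp)).symm
  | succ j ih =>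
    obtain ⟨s, hs, hps⟩ := ih (by omega)
    have key : ∀ A : Finset (Fin n), A.card = j + 1 → ∃ s' : (Fin n → AddCircle (1 : ℝ)) → B,
        ContinuousOn s' {x | ∀ i ∉ A, x i = 0} ∧ (∀ x, (∀ i ∉ A, x i = 0) → p (s' x) = x) ∧
        ∀ x, (∀ i ∉ A, x i = 0) → (∃ i ∈ A, x i = 0) → s' x = s x := by
      intro A hA
      have hr : range (A.orderEmbOfFin hA).toEmbedding = A := by simp
      have hmem : ∀ i, i ∉ range (A.orderEmbOfFin hA).toEmbedding ↔ i ∉ A := by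
        intro i; rw [hr]; simp
      have hex : ∀ x : Fin n → AddCircle (1 : ℝ),
          (∃ k, x ((A.orderEmbOfFin hA).toEmbedding k) = 0) ↔ ∃ i ∈ A, x i = 0 := by
        intro x
        constructor
        · rintro ⟨k, hk⟩
          exact ⟨_, A.orderEmbOfFin_mem hA k, hk⟩
        · rintro ⟨i, hi, hx⟩
          have : i ∈ range (A.orderEmbOfFin hA).toEmbedding := by rw [hr]; exact hi
          obtain ⟨k, rfl⟩ := this
          exact ⟨k, hx⟩
      have hsub : ∀ x : Fin n → AddCircle (1 : ℝ), (∀ i ∉ A, x i = 0) → (∃ i ∈ A, x i = 0) →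
          ∃ A : Finset (Fin n), A.card = j ∧ ∀ i ∉ A, x i = 0 := by
        rintro x hx ⟨i, hi, hxi⟩
        refine ⟨A.erase i, by rw [Finset.card_erase_of_mem hi, hA]; rfl, fun k hk => ?_⟩
        by_cases hki : k = i
        · rw [hki, hxi]
        · exact hx k fun hkA => hk (Finset.mem_erase.2 ⟨hki, hkA⟩)
      have := extend_face hB hP (A.orderEmbOfFin hA).toEmbedding s
      simp only [hmem, hex] at this
      exact this (hs.mono fun x hx => hsub x hx.1 hx.2) fun x h1 h2 => hps x (hsub x h1 h2)
    have : Nonempty ((Fin n → AddCircle (1 : ℝ)) → B) := ⟨s⟩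
    choose! sA hc hp hagree using key
    let supp : (Fin n → AddCircle (1 : ℝ)) → Finset (Fin n) := fun x =>
      Finset.univ.filter fun i => x i ≠ 0
    let s' : (Fin n → AddCircle (1 : ℝ)) → B := fun x =>
      if (supp x).card = j + 1 then sA (supp x) x else s x
    have hs' : ∀ A : Finset (Fin n), A.card = j + 1 → ∀ x, (∀ i ∉ A, x i = 0) →
        s' x = sA A x := by
      intro A hA x hx
      have hsub : supp x ⊆ A := by
        intro i hi
        by_contra hiA
        exact (Finset.mem_filter.1 hi).2 (hx i hiA)
      by_cases hcard : (supp x).card = j + 1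
      · have : supp x = A := Finset.eq_of_subset_of_card_le hsub (by omega)
        simp only [s', hA, if_true, this]
      · simp only [s', hcard, if_false]
        refine (hagree A hA x hx ?_).symm
        by_contra! hne
        apply hcard
        have : supp x = A := by
          apply Finset.Subset.antisymm hsub
          intro i hi
          exact Finset.mem_filter.2 ⟨Finset.mem_univ _, hne i hi⟩
        rw [this, hA]
    refine ⟨s', ?_, ?_⟩
    · have hU : {x : Fin n → AddCircle (1 : ℝ) |
          ∃ A : Finset (Fin n), A.card = j + 1 ∧ ∀ i ∉ A, x i = 0} =
          ⋃ A : {A : Finset (Fin n) // A.card = j + 1}, {x | ∀ i ∉ A.1, x i = 0} := by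
        ext x
        simp
      rw [hU]
      apply LocallyFinite.continuousOn_iUnion (locallyFinite_of_finite _)
      · intro A
        simp only [Set.ofPred_forall]
        refine isClosed_iInter fun i => isClosed_iInter fun _ => ?_
        exact isClosed_eq (continuous_apply i) continuous_const
      · rintro ⟨A, hA⟩
        exact (hc A hA).congr fun x hx => hs' A hA x hx
    · rintro x ⟨A, hA, hx⟩
      rw [hs' A hA x hx]
      exact hp A hA x hx

/-- A fibre bundle over the `n`-torus `Tⁿ = (ℝ/ℤ)ⁿ` with path-connected locally compact
Hausdorff fibre whose total space has property 𝒫 admits a continuous global section. -/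
theorem stmt_18 {B F : Type*} [TopologicalSpace B] [TopologicalSpace F]
    [PathConnectedSpace F] [LocallyCompactSpace F] [T2Space F] {n : ℕ}
    {p : B → (Fin n → AddCircle (1 : ℝ))} (hB : IsFiniteFiberBundle F p)
    (hP : HasPropP B) :
    ∃ s : (Fin n → AddCircle (1 : ℝ)) → B, Continuous s ∧ ∀ x, p (s x) = x := by
  obtain ⟨s, hs, hps⟩ := skeleton_section hB hP n le_rfl
  have h : ∀ x : Fin n → AddCircle (1 : ℝ), ∃ A : Finset (Fin n), A.card = n ∧ ∀ i ∉ A, x i = 0 :=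
    fun x => ⟨Finset.univ, by simp, by simp⟩
  refine ⟨s, ?_, fun x => hps x (h x)⟩
  rw [← continuousOn_univ]
  exact hs.mono fun x _ => h x
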